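/- Let (M^n, g) be a smooth Riemannian manifold with n ≥ 3 and let T be a Codazzi tensor on M which at every point has exactly two distinct eigenvalues ρ and σ, of multiplicity 1 and n−1 respectively, and let V_σ denote the (n−1)-dimensional eigendistribution of T relative to σ. If p is a critical point of σ (i.e. dσ(p) = 0), then the connected component through p of the integral leaf of V_σ is a totally geodesic hypersurface. -/

import Mathlib

noncomputable section

open scoped RealInnerProductSpace

/-- Euclidean model space `ℝⁿ`. -/
abbrev E (n : ℕ) : Type := EuclideanSpace ℝ (Fin n)

/-- The `i`-th standard coordinate vector of `ℝⁿ`. -/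
noncomputable def e (n : ℕ) (i : Fin n) : E n := EuclideanSpace.single i 1

/-- A smooth Riemannian metric, written in a single coordinate chart `U ⊆ ℝⁿ`, together
with its inverse metric and its Levi-Civita connection (encoded via the Christoffel
symbols `Γ`).  The fields `Γ_symm` (torsion-freeness) and `compat` (metric compatibility)
characterise the Levi-Civita connection uniquely. -/
structure RiemannChart (n : ℕ) where
  U : Set (E n)
  hU : IsOpen U
  g : E n → E n → E n → ℝ
  g_lin : ∀ p (a : ℝ) u v w, g p (a • u + v) w = a * g p u w + g p v w
  g_symm : ∀ p v w, g p v w = g p w v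
  g_posdef : ∀ p ∈ U, ∀ v, v ≠ 0 → 0 < g p v v
  g_smooth : ∀ v w, ContDiffOn ℝ (⊤ : ℕ∞) (fun q => g q v w) U
  ginv : E n → E n → E n → ℝ
  ginv_symm : ∀ p v w, ginv p v w = ginv p w v
  ginv_g : ∀ p ∈ U, ∀ i j : Fin n,
    (∑ k : Fin n, ginv p (e n i) (e n k) * g p (e n k) (e n j)) = if i = j then 1 else 0
  Γ : E n → E n → E n → E n
  Γ_lin : ∀ p (a : ℝ) u v w, Γ p (a • u + v) w = a • Γ p u w + Γ p v w
  Γ_symm : ∀ p v w, Γ p v w = Γ p w v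
  Γ_smooth : ∀ v w, ContDiffOn ℝ (⊤ : ℕ∞) (fun q => Γ q v w) U
  compat : ∀ p ∈ U, ∀ v w u,
    fderiv ℝ (fun q => g q w u) p v = g p (Γ p v w) u + g p w (Γ p v u)

namespace RiemannChart

variable {n : ℕ} (D : RiemannChart n)

/-- Covariant derivative `∇_v Y` of a vector field `Y` at `p`. -/
def covDeriv (Y : E n → E n) (p v : E n) : E n :=
  fderiv ℝ Y p v + D.Γ p v (Y p)

/-- Covariant derivative `(∇_v T)(w,u)` of a `(0,2)`-tensor field `T` at `p`. -/
def covDeriv2 (T : E n → E n → E n → ℝ) (p v w u : E n) : ℝ :=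
  fderiv ℝ (fun q => T q w u) p v - T p (D.Γ p v w) u - T p w (D.Γ p v u)

/-- `T` is a Codazzi tensor on `U`: a smooth symmetric bilinear form whose covariant
derivative is totally symmetric. -/
def IsCodazzi (T : E n → E n → E n → ℝ) : Prop :=
  (∀ p ∈ D.U, ∀ v w, T p v w = T p w v) ∧
  (∀ p ∈ D.U, ∀ (a : ℝ) u v w, T p (a • u + v) w = a * T p u w + T p v w) ∧
  (∀ v w, ContDiffOn ℝ (⊤ : ℕ∞) (fun q => T q v w) D.U) ∧
  (∀ p ∈ D.U, ∀ v w u, D.covDeriv2 T p v w u = D.covDeriv2 T p w v u)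

/-- The eigenspace (as a set) of the symmetric bilinear form `T` with respect to `g`,
at the point `p`, for the eigenvalue `lam`. -/
def eigenSet (T : E n → E n → E n → ℝ) (p : E n) (lam : ℝ) : Set (E n) :=
  {v | ∀ w, T p v w = lam * D.g p v w}

/-- The multiplicity of `lam` as an eigenvalue of `T` with respect to `g` at `p`. -/
def eigenMult (T : E n → E n → E n → ℝ) (p : E n) (lam : ℝ) : ℕ :=
  Module.finrank ℝ (Submodule.span ℝ (D.eigenSet T p lam))

/-- `T` has, at every point of `U`, exactly the two distinct eigenvalues `ρ p` (of
multiplicity `1`) and `σ p` (of multiplicity `n - 1`). -/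
def HasTwoEigenvalues (T : E n → E n → E n → ℝ) (ρ σ : E n → ℝ) : Prop :=
  (∀ p ∈ D.U, ρ p ≠ σ p) ∧
  (∀ p ∈ D.U, D.eigenMult T p (ρ p) = 1) ∧
  (∀ p ∈ D.U, D.eigenMult T p (σ p) = n - 1)

/-- The Riemann curvature tensor `R(v,w)z` at `p`, computed from the Christoffel
symbols by the usual coordinate formula. -/
def Riem (p v w z : E n) : E n :=
  fderiv ℝ (fun q => D.Γ q w z) p v - fderiv ℝ (fun q => D.Γ q v z) p w
    + D.Γ p v (D.Γ p w z) - D.Γ p w (D.Γ p v z)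

/-- The Ricci tensor `Ric(v,w) = tr (z ↦ R(z,v)w)` at `p`. -/
def Ric (p v w : E n) : ℝ := ∑ i : Fin n, D.Riem p (e n i) v w i

/-- The scalar curvature at `p`. -/
def scalar (p : E n) : ℝ :=
  ∑ i : Fin n, ∑ j : Fin n, D.ginv p (e n i) (e n j) * D.Ric p (e n i) (e n j)

/-- The Hessian `∇²f(v,w)` of a function `f` at `p`. -/
def Hess (f : E n → ℝ) (p v w : E n) : ℝ :=
  fderiv ℝ (fun q => fderiv ℝ f q w) p v - fderiv ℝ f p (D.Γ p v w)

/-- The gradient Ricci soliton equation `Ric + ∇²f = λ g` on `U`. -/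
def IsGradientSoliton (f : E n → ℝ) (lam : ℝ) : Prop :=
  ContDiffOn ℝ (⊤ : ℕ∞) f D.U ∧
  ∀ p ∈ D.U, ∀ v w, D.Ric p v w + D.Hess f p v w = lam * D.g p v w

/-- Strictly positive sectional curvature on `U`. -/
def PosSec : Prop :=
  ∀ p ∈ D.U, ∀ v w,
    0 < D.g p v v * D.g p w w - (D.g p v w) ^ 2 → 0 < D.g p (D.Riem p v w w) v

/-- Nonnegative sectional curvature on `U`. -/
def NonnegSec : Prop :=
  ∀ p ∈ D.U, ∀ v w,
    0 < D.g p v v * D.g p w w - (D.g p v w) ^ 2 → 0 ≤ D.g p (D.Riem p v w w) v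

/-- The distribution `Vd` is totally geodesic (autoparallel) at `p`: the covariant
derivative of any vector field tangent to `Vd`, in a direction tangent to `Vd`,
stays tangent to `Vd`. -/
def TotallyGeodesicAt (Vd : E n → Set (E n)) (p : E n) : Prop :=
  ∀ Y : E n → E n, DifferentiableAt ℝ Y p → (∀ q ∈ D.U, Y q ∈ Vd q) →
    ∀ v ∈ Vd p, D.covDeriv Y p v ∈ Vd p

/-- `S` is an integral hypersurface of the `(n-1)`-dimensional distribution `Vd`:
near each of its points it is a smoothly parametrised hypersurface whose tangent
spaces are given by `Vd`. -/
def IsIntegralHypersurface (Vd : E n → Set (E n)) (S : Set (E n)) : Prop :=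
  S ⊆ D.U ∧
  ∀ q ∈ S, ∃ (φ : E (n - 1) → E n) (V : Set (E n)),
    IsOpen V ∧ q ∈ V ∧ V ⊆ D.U ∧ ContDiff ℝ (⊤ : ℕ∞) φ ∧
    (∀ x, φ x ∈ D.U → Set.range (fun u => fderiv ℝ φ x u) = Vd (φ x)) ∧
    S ∩ V = Set.range φ ∩ V

/-- On the subset `A ⊆ U`, around each of its points the metric is isometric to a
warped product `dt² + w(t)² h` of an `(n-1)`-dimensional Riemannian manifold `(N,h)`
over an interval `I ⊆ ℝ`; moreover `σ` only depends on the interval variable and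
the tangent spaces of the warping hypersurfaces (the `t = const` leaves) are
prescribed by the distribution `Vd`. -/
def LocallyWarpedProductOn (A : Set (E n)) (σ : E n → ℝ) (Vd : E n → Set (E n)) : Prop :=
  ∀ p ∈ A, ∃ (V : Set (E n)) (φ : E n → ℝ × E (n - 1)) (I : Set ℝ) (N : Set (E (n - 1)))
      (w : ℝ → ℝ) (h : E (n - 1) → E (n - 1) → E (n - 1) → ℝ) (s : ℝ → ℝ),
    IsOpen V ∧ p ∈ V ∧ V ⊆ D.U ∧
    IsOpen I ∧ I.OrdConnected ∧ I.Nonempty ∧ IsOpen N ∧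
    ContDiffOn ℝ (⊤ : ℕ∞) φ V ∧ Set.InjOn φ V ∧ φ '' V ⊆ I ×ˢ N ∧
    ContDiff ℝ (⊤ : ℕ∞) w ∧ (∀ t, 0 < w t) ∧
    (∀ x ∈ N, ∀ a b, h x a b = h x b a) ∧
    (∀ x ∈ N, ∀ (c : ℝ) (a a' b : E (n - 1)), h x (c • a + a') b = c * h x a b + h x a' b) ∧
    (∀ x ∈ N, ∀ a, a ≠ 0 → 0 < h x a a) ∧
    (∀ q ∈ V ∩ A, ∀ v u : E n,
      D.g q v u = (fderiv ℝ φ q v).1 * (fderiv ℝ φ q u).1 +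
        (w (φ q).1) ^ 2 * h (φ q).2 (fderiv ℝ φ q v).2 (fderiv ℝ φ q u).2) ∧
    (∀ q ∈ V ∩ A, σ q = s (φ q).1) ∧
    (∀ q ∈ V ∩ A, ∀ v : E n, ((fderiv ℝ φ q v).1 = 0 ↔ v ∈ Vd q))

end RiemannChart

section Topology

open Set Topology

theorem countable_image_of_forall_mem_nhdsWithin {X Y : Type*} [TopologicalSpace X]
    [SecondCountableTopology X] {f : X → Y} {s : Set X}
    (h : ∀ x ∈ s, ∃ t ∈ 𝓝[s] x, (f '' t).Countable) : (f '' s).Countable := by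
  choose! t ht htc using h
  obtain ⟨c, hcs, hc, hcov⟩ := TopologicalSpace.countable_cover_nhdsWithin ht
  refine (hc.biUnion fun x hx => htc x (hcs hx)).mono ?_
  rintro _ ⟨x, hx, rfl⟩
  obtain ⟨y, hy, hxy⟩ := mem_iUnion₂.1 (hcov hx)
  exact mem_iUnion₂.2 ⟨y, hy, x, hxy, rfl⟩

theorem countable_image_of_fderiv_eq_zero {F : Type*} [NormedAddCommGroup F] [NormedSpace ℝ F]
    [SecondCountableTopology F] {f : F → ℝ} {s : Set F} (hs : IsOpen s)
    (hf : ∀ x ∈ s, DifferentiableAt ℝ f x) (hf' : ∀ x ∈ s, fderiv ℝ f x = 0) :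
    (f '' s).Countable := by
  refine countable_image_of_forall_mem_nhdsWithin fun x hx => ?_
  obtain ⟨r, hr, hrs⟩ := Metric.isOpen_iff.1 hs x hx
  refine ⟨Metric.ball x r, mem_nhdsWithin_of_mem_nhds (Metric.ball_mem_nhds x hr), ?_⟩
  refine (countable_singleton (f x)).mono ?_
  rintro _ ⟨y, hy, rfl⟩
  exact Metric.isOpen_ball.is_const_of_fderiv_eq_zero (convex_ball x r).isPreconnected
    (fun z hz => (hf z (hrs hz)).differentiableWithinAt) (fun z hz => hf' z (hrs hz))
    hy (Metric.mem_ball_self hr)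

end Topology

namespace RiemannChart

open Filter Topology

section Metric

variable {n : ℕ} (D : RiemannChart n)

/-- The linear form `g_p(·, w)`. -/
def gLeft (p w : E n) : E n →ₗ[ℝ] ℝ :=
  IsLinearMap.mk' (fun v => D.g p v w) <| by
    have h0 : D.g p 0 w = 0 := by
      have := D.g_lin p 1 0 0 w
      simp at this
      exact this
    constructor
    · intro u v; simpa using D.g_lin p 1 u v w
    · intro a u; simpa [h0] using D.g_lin p a u 0 w

@[simp] theorem gLeft_apply (p w v : E n) : D.gLeft p w v = D.g p v w := rfl

theorem g_add_left (p u v w : E n) : D.g p (u + v) w = D.g p u w + D.g p v w :=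
  (D.gLeft p w).map_add u v

theorem g_sub_left (p u v w : E n) : D.g p (u - v) w = D.g p u w - D.g p v w :=
  (D.gLeft p w).map_sub u v

theorem g_smul_left (p : E n) (a : ℝ) (u w : E n) : D.g p (a • u) w = a * D.g p u w :=
  (D.gLeft p w).map_smul a u

theorem g_self_nonneg {p : E n} (hp : p ∈ D.U) (v : E n) : 0 ≤ D.g p v v := by
  by_cases hv : v = 0
  · subst hv; exact ((D.gLeft p 0).map_zero).ge
  · exact (D.g_posdef p hp v hv).le

theorem sq_g_le_of_unit {p : E n} (hp : p ∈ D.U) {N : E n} (hN : D.g p N N = 1) (w : E n) :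
    D.g p w N ^ 2 ≤ D.g p w w := by
  have h := D.g_self_nonneg hp (w - D.g p w N • N)
  rw [g_sub_left, g_smul_left, D.g_symm p w, D.g_symm p N (w - _), g_sub_left, g_sub_left,
    g_smul_left, g_smul_left, hN, D.g_symm p N w] at h
  nlinarith

theorem differentiableAt_g {q : E n} (hq : q ∈ D.U) (u v : E n) :
    DifferentiableAt ℝ (fun x => D.g x u v) q :=
  ((D.g_smooth u v).contDiffAt (D.hU.mem_nhds hq)).differentiableAt (by simp)

theorem exists_ne_zero_orthogonal_pair (hn : 3 ≤ n) (p u v : E n) :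
    ∃ y, y ≠ 0 ∧ D.g p y u = 0 ∧ D.g p y v = 0 := by
  have hker : LinearMap.ker ((D.gLeft p u).prod (D.gLeft p v)) ≠ ⊥ := by
    apply LinearMap.ker_ne_bot_of_finrank_lt
    simp
    omega
  obtain ⟨y, hy, hy0⟩ := Submodule.exists_mem_ne_zero_of_ne_bot hker
  simp [LinearMap.mem_ker] at hy
  exact ⟨y, hy0, hy.1, hy.2⟩

end Metric

/-- `σ g + B` is a Codazzi tensor, where `B` has the form `μ N♭ ⊗ N♭` with `N` a (possibly
discontinuous) unit field and `μ` nowhere zero. -/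
structure IsRankOneCodazzi {n : ℕ} (D : RiemannChart n) (B : E n → E n → E n → ℝ)
    (μ σ : E n → ℝ) (N : E n → E n) : Prop where
  unit : ∀ x ∈ D.U, D.g x (N x) (N x) = 1
  eq : ∀ x ∈ D.U, ∀ u v, B x u v = μ x * D.g x u (N x) * D.g x v (N x)
  ne_zero : ∀ x ∈ D.U, μ x ≠ 0
  differentiableAt_coeff : ∀ x ∈ D.U, DifferentiableAt ℝ μ x
  differentiableAt : ∀ u v, ∀ x ∈ D.U, DifferentiableAt ℝ (fun y => B y u v) x
  contDiffOn : ContDiffOn ℝ (⊤ : ℕ∞) σ D.U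
  codazzi : ∀ x ∈ D.U, ∀ v w u,
    D.covDeriv2 B x v w u + fderiv ℝ σ x v * D.g x w u =
      D.covDeriv2 B x w v u + fderiv ℝ σ x w * D.g x v u

namespace IsRankOneCodazzi

variable {n : ℕ} {D : RiemannChart n} {B : E n → E n → E n → ℝ} {μ σ : E n → ℝ}
  {N : E n → E n}

theorem apply_eq_zero (h : D.IsRankOneCodazzi B μ σ N) {q : E n}
    (hq : q ∈ D.U) {u : E n} (hu : D.g q u (N q) = 0) (v : E n) : B q u v = 0 := by
  rw [h.eq q hq, hu]; ring

theorem apply_eq_zero_right (h : D.IsRankOneCodazzi B μ σ N) {q : E n}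
    (hq : q ∈ D.U) {u : E n} (hu : D.g q u (N q) = 0) (v : E n) : B q v u = 0 := by
  rw [h.eq q hq, hu]; ring

theorem fderiv_diag_eq_zero (h : D.IsRankOneCodazzi B μ σ N) {q : E n}
    (hq : q ∈ D.U) {Y : E n} (hY : D.g q Y (N q) = 0) :
    fderiv ℝ (fun x => B x Y Y) q = 0 := by
  have hmin : IsLocalMin (fun x => μ x * B x Y Y) q := by
    filter_upwards [D.hU.mem_nhds hq] with x hx
    rw [h.apply_eq_zero hq hY, h.eq x hx]
    nlinarith [sq_nonneg (μ x * D.g x Y (N x))]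
  have h0 := hmin.fderiv_eq_zero
  rw [fderiv_fun_mul (h.differentiableAt_coeff q hq) (h.differentiableAt Y Y q hq),
    h.apply_eq_zero hq hY, zero_smul, add_zero] at h0
  exact (smul_eq_zero_iff_right (M := E n →L[ℝ] ℝ) (h.ne_zero q hq)).1 h0

theorem fderiv_eq_zero (h : D.IsRankOneCodazzi B μ σ N) {q : E n}
    (hq : q ∈ D.U) {X Y : E n} (hX : D.g q X (N q) = 0) (hY : D.g q Y (N q) = 0) :
    fderiv ℝ (fun x => B x X Y) q = 0 := by
  have hXY : D.g q (X + Y) (N q) = 0 := by rw [g_add_left, hX, hY, add_zero]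
  have heq : (fun x => B x (X + Y) (X + Y)) =ᶠ[𝓝 q]
      fun x => B x X X + B x Y Y + 2 * B x X Y := by
    filter_upwards [D.hU.mem_nhds hq] with x hx
    simp only [h.eq x hx, g_add_left]
    ring
  have h1 := heq.fderiv_eq (𝕜 := ℝ)
  rw [h.fderiv_diag_eq_zero hq hXY,
    fderiv_fun_add ((h.differentiableAt X X q hq).fun_add (h.differentiableAt Y Y q hq))
      ((h.differentiableAt X Y q hq).const_mul (2 : ℝ)),
    fderiv_fun_add (h.differentiableAt X X q hq) (h.differentiableAt Y Y q hq),
    h.fderiv_diag_eq_zero hq hX, h.fderiv_diag_eq_zero hq hY,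
    fderiv_const_mul (h.differentiableAt X Y q hq)] at h1
  simpa using h1.symm

theorem covDeriv2_eq_zero (h : D.IsRankOneCodazzi B μ σ N) {q : E n}
    (hq : q ∈ D.U) {X Y : E n} (hX : D.g q X (N q) = 0) (hY : D.g q Y (N q) = 0)
    (w : E n) : D.covDeriv2 B q w X Y = 0 := by
  simp [covDeriv2, h.fderiv_eq_zero hq hX hY, h.apply_eq_zero hq hX,
    h.apply_eq_zero_right hq hY]

theorem fderiv_eigenvalue_eq_zero (h : D.IsRankOneCodazzi B μ σ N) {q : E n}
    (hq : q ∈ D.U) (hn : 3 ≤ n) {X : E n} (hX : D.g q X (N q) = 0) :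
    fderiv ℝ σ q X = 0 := by
  obtain ⟨Y, hY0, hYX, hYN⟩ := D.exists_ne_zero_orthogonal_pair hn q X (N q)
  have hc := h.codazzi q hq X Y Y
  rw [h.covDeriv2_eq_zero hq hYN hYN, h.covDeriv2_eq_zero hq hX hYN, D.g_symm q X, hYX] at hc
  simpa [(D.g_posdef q hq Y hY0).ne'] using hc

theorem fderiv_eigenvalue_apply (h : D.IsRankOneCodazzi B μ σ N) {q : E n}
    (hq : q ∈ D.U) (hn : 3 ≤ n) (v : E n) :
    fderiv ℝ σ q v = fderiv ℝ σ q (N q) * D.g q v (N q) := by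
  have h0 : D.g q (v - D.g q v (N q) • N q) (N q) = 0 := by
    rw [g_sub_left, g_smul_left, h.unit q hq]; ring
  have h1 := h.fderiv_eigenvalue_eq_zero hq hn h0
  rw [map_sub, map_smul, smul_eq_mul] at h1
  linarith

/-- At a critical point of `σ` the distribution orthogonal to `N` is autoparallel. -/
theorem g_covDeriv_eq_zero (h : D.IsRankOneCodazzi B μ σ N) {q : E n}
    (hq : q ∈ D.U) (hσ : fderiv ℝ σ q = 0) {Y : E n → E n}
    (hY : DifferentiableAt ℝ Y q) (hYN : ∀ x ∈ D.U, D.g x (Y x) (N x) = 0) {v : E n}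
    (hv : D.g q v (N q) = 0) : D.g q (D.covDeriv Y q v) (N q) = 0 := by
  set u := N q with hu
  have hexp : ∀ x ∈ D.U, ∀ y : E n, B x y u = ∑ i, y i * B x (e n i) u := by
    intro x hx y
    have hy : y = ∑ i, y i • e n i := by
      simpa [e] using ((EuclideanSpace.basisFun (Fin n) ℝ).sum_repr y).symm
    have : D.g x y (N x) = ∑ i, y i * D.g x (e n i) (N x) := by
      conv_lhs => rw [hy]
      rw [← gLeft_apply, map_sum]
      simp
    simp only [h.eq x hx, this, Finset.mul_sum, Finset.sum_mul]
    exact Finset.sum_congr rfl fun i _ => by ring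
  have hsum : (fun x => ∑ i, Y x i * B x (e n i) u) =ᶠ[𝓝 q] fun _ => 0 := by
    filter_upwards [D.hU.mem_nhds hq] with x hx
    rw [← hexp x hx, h.apply_eq_zero hx (hYN x hx)]
  have hYi : ∀ i, HasFDerivAt (fun x => Y x i)
      ((EuclideanSpace.proj i : E n →L[ℝ] ℝ).comp (fderiv ℝ Y q)) q := fun i =>
    (EuclideanSpace.proj i : E n →L[ℝ] ℝ).hasFDerivAt.comp q hY.hasFDerivAt
  have hd := HasFDerivAt.fun_sum (u := Finset.univ) fun i _ =>
    (hYi i).mul (h.differentiableAt (e n i) u q hq).hasFDerivAt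
  have hconst : HasFDerivAt (fun x => ∑ i, Y q i * B x (e n i) u)
      (∑ i, Y q i • fderiv ℝ (fun x => B x (e n i) u) q) q :=
    HasFDerivAt.fun_sum fun i _ =>
      (h.differentiableAt (e n i) u q hq).hasFDerivAt.const_mul (Y q i)
  have hconst' : fderiv ℝ (fun x => B x (Y q) u) q =
      ∑ i, Y q i • fderiv ℝ (fun x => B x (e n i) u) q := by
    rw [← hconst.fderiv]
    apply EventuallyEq.fderiv_eq
    filter_upwards [D.hU.mem_nhds hq] with x hx using hexp x hx _
  have h0 := hd.fderiv.symm.trans (hsum.fderiv_eq.trans (fderiv_const_apply (0 : ℝ)))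
  have h1 : fderiv ℝ (fun x => B x (Y q) u) q v + B q (fderiv ℝ Y q v) u = 0 := by
    have := congrArg (fun L : E n →L[ℝ] ℝ => L v) h0
    rw [hconst', hexp q hq]
    simpa [Finset.sum_add_distrib, mul_comm] using this
  have hc := h.codazzi q hq v u (Y q)
  have hsymm : D.covDeriv2 B q v u (Y q) = D.covDeriv2 B q v (Y q) u := by
    have hs : (fun x => B x u (Y q)) =ᶠ[𝓝 q] fun x => B x (Y q) u := by
      filter_upwards [D.hU.mem_nhds hq] with x hx
      rw [h.eq x hx, h.eq x hx]; ring
    rw [covDeriv2, covDeriv2, hs.fderiv_eq]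
    simp only [h.eq q hq]; ring
  rw [hσ, h.covDeriv2_eq_zero hq hv (hYN q hq), hsymm, covDeriv2,
    h.apply_eq_zero hq (hYN q hq)] at hc
  simp only [_root_.zero_apply, zero_mul, add_zero, sub_zero] at hc
  have h2 : B q (D.covDeriv Y q v) u = 0 := by
    simp only [h.eq q hq] at hc h1 ⊢
    rw [covDeriv, g_add_left]
    linarith
  rw [h.eq q hq, h.unit q hq, mul_one] at h2
  exact (mul_eq_zero.1 h2).resolve_left (h.ne_zero q hq)

/-- The gradient of the squared mean curvature `(Nσ / μ)²` of the leaves orthogonal to `N`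
vanishes along the leaves. -/
theorem differentiableAt_and_fderiv_sq_meanCurvature_eq_zero (h : D.IsRankOneCodazzi B μ σ N) {q : E n}
    (hq : q ∈ D.U) (hn : 3 ≤ n) :
    DifferentiableAt ℝ (fun x => (fderiv ℝ σ x (N x) / μ x) ^ 2) q ∧
      ∀ X, D.g q X (N q) = 0 →
        fderiv ℝ (fun x => (fderiv ℝ σ x (N x) / μ x) ^ 2) q X = 0 := by
  set w := N q with hw
  have hU := D.hU.mem_nhds hq
  have hμ := h.ne_zero q hq
  have hdμ := h.differentiableAt_coeff q hq
  have hdb := h.differentiableAt w w q hq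
  have hww : D.g q w w = 1 := h.unit q hq
  have hb : B q w w = μ q := by rw [h.eq q hq, hww]; ring
  have hσq : ContDiffAt ℝ (⊤ : ℕ∞) σ q := h.contDiffOn.contDiffAt hU
  have hdσ : DifferentiableAt ℝ (fderiv ℝ σ) q :=
    (hσq.fderiv_right (m := 1) (by norm_cast)).differentiableAt (by simp)
  have hdσv : ∀ v, HasFDerivAt (fun x => fderiv ℝ σ x v)
      ((fderiv ℝ (fderiv ℝ σ) q).flip v) q := fun v => by
    simpa using hdσ.hasFDerivAt.clm_apply (hasFDerivAt_const v q)
  have hden : DifferentiableAt ℝ (fun x => μ x * B x w w) q := hdμ.mul hdb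
  have hden0 : μ q * B q w w ≠ 0 := by rw [hb]; exact mul_ne_zero hμ hμ
  have hne : ∀ᶠ x in 𝓝 q, μ x * B x w w ≠ 0 := hden.continuousAt.eventually_ne hden0
  have hK : (fun x => (fderiv ℝ σ x (N x) / μ x) ^ 2) =ᶠ[𝓝 q]
      fun x => fderiv ℝ σ x w ^ 2 / (μ x * B x w w) := by
    filter_upwards [hne, D.hU.mem_nhds hq] with x hx hxU
    have hμx := h.ne_zero x hxU
    rw [eq_div_iff hx, h.fderiv_eigenvalue_apply hxU hn w, h.eq x hxU]
    field_simp
  have hKd : DifferentiableAt ℝ (fun x => (fderiv ℝ σ x (N x) / μ x) ^ 2) q :=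
    (((hdσv w).differentiableAt.fun_pow 2).fun_mul (hden.fun_inv hden0)).congr_of_eventuallyEq
      (by simpa only [div_eq_mul_inv] using hK)
  refine ⟨hKd, fun X hX => ?_⟩
  have hprod : (fun x => (fderiv ℝ σ x (N x) / μ x) ^ 2 * (μ x * B x w w)) =ᶠ[𝓝 q]
      fun x => fderiv ℝ σ x w ^ 2 := by
    filter_upwards [hne, hK] with x hx hKx
    rw [hKx, div_mul_cancel₀ _ hx]
  have hKX := congrArg (fun L : E n →L[ℝ] ℝ => L X) (((hKd.hasFDerivAt.mul
    (hdμ.hasFDerivAt.mul hdb.hasFDerivAt)).congr_of_eventuallyEq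
      hprod.symm).unique ((hdσv w).pow 2))
  -- the Hessian of `σ` in the directions `X`, `w`
  have hrank : (fun x => fderiv ℝ σ x X * B x w w) =ᶠ[𝓝 q]
      fun x => fderiv ℝ σ x w * B x X w := by
    filter_upwards [D.hU.mem_nhds hq] with x hx
    rw [h.fderiv_eigenvalue_apply hx hn X, h.fderiv_eigenvalue_apply hx hn w]
    simp only [h.eq x hx]
    ring
  have hHess := congrArg (fun L : E n →L[ℝ] ℝ => L w)
    ((((hdσv X).mul hdb.hasFDerivAt).congr_of_eventuallyEq hrank.symm).unique
      ((hdσv w).mul (h.differentiableAt X w q hq).hasFDerivAt))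
  have hsymm : fderiv ℝ (fderiv ℝ σ) q X w = fderiv ℝ (fderiv ℝ σ) q w X :=
    (hσq.isSymmSndFDerivAt (by simp; norm_cast)).eq X w
  -- `w` maximises the Rayleigh quotient of `μ B` at `q`
  have hmax : IsLocalMax (fun x => μ x * (B x w w - μ x * D.g x w w)) q := by
    filter_upwards [D.hU.mem_nhds hq] with x hx
    rw [hb, hww, mul_one, sub_self, mul_zero, h.eq x hx]
    nlinarith [mul_nonneg (sq_nonneg (μ x))
      (sub_nonneg.2 (D.sq_g_le_of_unit hx (h.unit x hx) w))]
  have hRay := congrArg (fun L : E n →L[ℝ] ℝ => L X) (hmax.hasFDerivAt_eq_zero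
    (hdμ.hasFDerivAt.mul (hdb.hasFDerivAt.sub
      (hdμ.hasFDerivAt.mul (D.differentiableAt_g hq w w).hasFDerivAt))))
  have hc := h.codazzi q hq X w w
  have hX0 := h.fderiv_eigenvalue_eq_zero hq hn hX
  rw [hX0, show D.g q X w = 0 from hX, covDeriv2, covDeriv2, h.apply_eq_zero hq hX,
    D.Γ_symm q w X] at hc
  simp only [h.eq q hq (D.Γ q X w), h.eq q hq w, ← hw, hww] at hc
  have hcompat := D.compat q hq X w w
  rw [D.g_symm q w] at hcompat
  simp [hb, hww, hcompat, hμ] at hRay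
  simp [h.apply_eq_zero hq hX, hX0, hb] at hHess
  simp [hb] at hKX
  generalize fderiv ℝ (fun x => (fderiv ℝ σ x (N x) / μ x) ^ 2) q X = k at hKX ⊢
  rw [hsymm, ← hw] at hKX
  field_simp at hKX
  refine (mul_eq_zero.1 ?_).resolve_left (pow_ne_zero 3 hμ)
  linear_combination hKX + 2 * fderiv ℝ σ q w * hHess + fderiv ℝ σ q w ^ 2 * hRay -
    2 * fderiv ℝ σ q w ^ 2 * hc

end IsRankOneCodazzi

section Splitting

variable {n : ℕ} {D : RiemannChart n} {T : E n → E n → E n → ℝ}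

theorem IsCodazzi.exists_linearMap (hT : D.IsCodazzi T) {p : E n} (hp : p ∈ D.U) (w : E n) :
    ∃ L : E n →ₗ[ℝ] ℝ, ∀ v, L v = T p v w := by
  have h0 : T p 0 w = 0 := by
    have := hT.2.1 p hp 1 0 0 w
    simp at this
    exact this
  refine ⟨IsLinearMap.mk' (fun v => T p v w) ⟨fun u v => ?_, fun a u => ?_⟩, fun v => rfl⟩
  · simpa using hT.2.1 p hp 1 u v w
  · simpa [h0] using hT.2.1 p hp a u 0 w

theorem IsCodazzi.exists_submodule_eq_eigenSet (hT : D.IsCodazzi T) {p : E n} (hp : p ∈ D.U)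
    (lam : ℝ) : ∃ W : Submodule ℝ (E n), (W : Set (E n)) = D.eigenSet T p lam := by
  choose L hL using fun w => hT.exists_linearMap hp w
  refine ⟨⨅ w, LinearMap.ker (L w - lam • D.gLeft p w), ?_⟩
  ext v
  simp [eigenSet, hL, sub_eq_zero]

/-- A unit eigenvector for the simple eigenvalue spans the orthogonal complement of the other
eigenspace. -/
theorem exists_unit_normal (hT : D.IsCodazzi T) {ρ σ : E n → ℝ}
    (h2 : D.HasTwoEigenvalues T ρ σ) {p : E n} (hp : p ∈ D.U) :
    ∃ N, D.g p N N = 1 ∧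
      (∀ v, v ∈ D.eigenSet T p (σ p) ↔ D.g p v N = 0) ∧
      ∀ u v, T p u v - σ p * D.g p u v = (ρ p - σ p) * D.g p u N * D.g p v N := by
  obtain ⟨hne, hρ, hσ⟩ := h2
  obtain ⟨R, hR⟩ := hT.exists_submodule_eq_eigenSet hp (ρ p)
  obtain ⟨W, hW⟩ := hT.exists_submodule_eq_eigenSet hp (σ p)
  have hRdim : Module.finrank ℝ R = 1 := by
    have := hρ p hp
    rwa [eigenMult, ← hR, Submodule.span_eq] at this
  have hWdim : Module.finrank ℝ W = n - 1 := by
    have := hσ p hp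
    rwa [eigenMult, ← hW, Submodule.span_eq] at this
  obtain ⟨N₀, hN₀R, hN₀⟩ := Submodule.exists_mem_ne_zero_of_ne_bot (p := R) (by
    rintro rfl; simp at hRdim)
  have hpos := D.g_posdef p hp N₀ hN₀
  obtain ⟨N, hNN, hNR⟩ : ∃ N, D.g p N N = 1 ∧ N ∈ D.eigenSet T p (ρ p) := by
    refine ⟨(Real.sqrt (D.g p N₀ N₀))⁻¹ • N₀, ?_, hR.subset (R.smul_mem _ hN₀R)⟩
    rw [g_smul_left, D.g_symm p N₀ (_ • _), g_smul_left]
    have := Real.mul_self_sqrt hpos.le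
    have := (Real.sqrt_pos.2 hpos).ne'
    field_simp
    nlinarith
  have hle : W ≤ LinearMap.ker (D.gLeft p N) := by
    intro v hv
    have hv' : v ∈ D.eigenSet T p (σ p) := by rw [← hW]; exact hv
    have h1 := hv' N
    have h3 := hNR v
    rw [hT.1 p hp, D.g_symm] at h3
    have : (ρ p - σ p) * D.g p v N = 0 := by linarith
    simpa [sub_ne_zero.2 (hne p hp)] using this
  have hlin : D.gLeft p N ≠ 0 := by
    intro h0
    have := congrArg (fun L : E n →ₗ[ℝ] ℝ => L N) h0
    simp [hNN] at this
  have hker : W = LinearMap.ker (D.gLeft p N) := by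
    apply Submodule.eq_of_le_of_finrank_eq hle
    have := Module.Dual.finrank_ker_add_one_of_ne_zero hlin
    rw [finrank_euclideanSpace, Fintype.card_fin] at this
    omega
  have hiff : ∀ v, v ∈ D.eigenSet T p (σ p) ↔ D.g p v N = 0 := fun v => by
    rw [← hW, SetLike.mem_coe, hker, LinearMap.mem_ker, gLeft_apply]
  refine ⟨N, hNN, hiff, fun u v => ?_⟩
  have hu : u - D.g p u N • N ∈ D.eigenSet T p (σ p) := by
    rw [hiff, g_sub_left, g_smul_left, hNN]; ring
  have hu' := hu v
  obtain ⟨L, hL⟩ := hT.exists_linearMap hp v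
  rw [← hL, map_sub, map_smul, hL, hL, hNR v, g_sub_left, g_smul_left, smul_eq_mul,
    D.g_symm p N v] at hu'
  linarith

theorem IsCodazzi.exists_isRankOneCodazzi (hT : D.IsCodazzi T) {ρ σ : E n → ℝ}
    (h2 : D.HasTwoEigenvalues T ρ σ) (hρ : ContDiffOn ℝ (⊤ : ℕ∞) ρ D.U)
    (hσ : ContDiffOn ℝ (⊤ : ℕ∞) σ D.U) :
    ∃ N, D.IsRankOneCodazzi (fun x u v => T x u v - σ x * D.g x u v) (fun x => ρ x - σ x) σ N ∧
      ∀ x ∈ D.U, ∀ v, v ∈ D.eigenSet T x (σ x) ↔ D.g x v (N x) = 0 := by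
  choose! N hunit hiff heq using fun x (hx : x ∈ D.U) => exists_unit_normal hT h2 hx
  have hdσ : ∀ x ∈ D.U, DifferentiableAt ℝ σ x := fun x hx =>
    (hσ.contDiffAt (D.hU.mem_nhds hx)).differentiableAt (by simp)
  have hdρ : ∀ x ∈ D.U, DifferentiableAt ℝ ρ x := fun x hx =>
    (hρ.contDiffAt (D.hU.mem_nhds hx)).differentiableAt (by simp)
  have hdT : ∀ u v, ∀ x ∈ D.U, DifferentiableAt ℝ (fun y => T y u v) x := fun u v x hx =>
    ((hT.2.2.1 u v).contDiffAt (D.hU.mem_nhds hx)).differentiableAt (by simp)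
  refine ⟨N, ⟨hunit, heq, fun x hx => sub_ne_zero.2 (h2.1 x hx),
    fun x hx => (hdρ x hx).sub (hdσ x hx),
    fun u v x hx => (hdT u v x hx).sub ((hdσ x hx).mul (D.differentiableAt_g hx u v)), hσ,
    fun x hx v w u => ?_⟩, hiff⟩
  have key : ∀ v w u, D.covDeriv2 (fun x u v => T x u v - σ x * D.g x u v) x v w u +
      fderiv ℝ σ x v * D.g x w u = D.covDeriv2 T x v w u := fun v w u => by
    have hd := ((hdT w u x hx).hasFDerivAt.sub
      ((hdσ x hx).hasFDerivAt.mul (D.differentiableAt_g hx w u).hasFDerivAt)).fderiv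
    have hd' := congrArg (fun L : E n →L[ℝ] ℝ => L v) hd
    simp only [_root_.sub_apply, _root_.add_apply,
      _root_.smul_apply, smul_eq_mul, D.compat x hx] at hd'
    simp only [covDeriv2]
    refine (congrArg (fun t => t - _ - _ + _) hd').trans ?_
    ring
  rw [key, key, hT.2.2.2 x hx]

end Splitting

end RiemannChart

/-- If a Codazzi tensor `T` on `(Mⁿ,g)`, `n ≥ 3`, has at every point
exactly two distinct eigenvalues `ρ` and `σ` of multiplicities `1` and `n-1`, and `p`
is a critical point of `σ` (`dσ(p) = 0`), then the connected component through `p` of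
the integral leaf of the eigendistribution `V_σ` is a totally geodesic hypersurface. -/
theorem codazzi_critical_point_leaf_totally_geodesic
    {n : ℕ} (hn : 3 ≤ n) (D : RiemannChart n)
    (T : E n → E n → E n → ℝ) (ρ σ : E n → ℝ)
    (hT : D.IsCodazzi T) (h2 : D.HasTwoEigenvalues T ρ σ)
    (hρ : ContDiffOn ℝ (⊤ : ℕ∞) ρ D.U) (hσ : ContDiffOn ℝ (⊤ : ℕ∞) σ D.U) :
    ∀ p ∈ D.U, fderiv ℝ σ p = 0 →
      ∀ S : Set (E n), p ∈ S → IsPreconnected S →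
        D.IsIntegralHypersurface (fun q => D.eigenSet T q (σ q)) S →
        ∀ q ∈ S, D.TotallyGeodesicAt (fun r => D.eigenSet T r (σ r)) q := by
  intro p hp hcrit S hpS hS ⟨hSU, hSφ⟩ q hq
  obtain ⟨N, h, hiff⟩ := hT.exists_isRankOneCodazzi h2 hρ hσ
  set K : E n → ℝ := fun x => (fderiv ℝ σ x (N x) / (ρ x - σ x)) ^ 2 with hK
  have hKd := fun x (hx : x ∈ D.U) => h.differentiableAt_and_fderiv_sq_meanCurvature_eq_zero hx hn
  have hcount : (K '' S).Countable := by
    refine countable_image_of_forall_mem_nhdsWithin fun x hx => ?_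
    obtain ⟨φ, V, hV, hxV, hVU, hφ, hrange, hSV⟩ := hSφ x hx
    refine ⟨S ∩ V, inter_mem_nhdsWithin S (hV.mem_nhds hxV), ?_⟩
    have hsub : K '' (S ∩ V) ⊆ (K ∘ φ) '' (φ ⁻¹' V) := by
      rw [hSV]
      rintro _ ⟨_, ⟨⟨y, rfl⟩, hy⟩, rfl⟩
      exact ⟨y, hy, rfl⟩
    refine Set.Countable.mono hsub (countable_image_of_fderiv_eq_zero
      (hV.preimage hφ.continuous) (fun y hy => ?_) fun y hy => ?_)
    · exact (hKd _ (hVU hy)).1.comp y (hφ.differentiable (by simp) y)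
    · rw [fderiv_comp y (hKd _ (hVU hy)).1 (hφ.differentiable (by simp) y)]
      ext u
      refine (hKd _ (hVU hy)).2 _ ((hiff _ (hVU hy) _).1 ?_)
      exact (hrange y (hVU hy)).subset ⟨u, rfl⟩
  have hconn : IsPreconnected (K '' S) :=
    hS.image K fun x hx => (hKd x (hSU hx)).1.continuousAt.continuousWithinAt
  have hKq : K q = K p :=
    hcount.isTotallyDisconnected _ subset_rfl hconn ⟨q, hq, rfl⟩ ⟨p, hpS, rfl⟩
  have hqU := hSU hq
  have hσq : fderiv ℝ σ q = 0 := by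
    have hNq : fderiv ℝ σ q (N q) = 0 := by
      simpa [hK, hcrit, sub_ne_zero.2 (h2.1 q hqU)] using hKq
    ext v
    rw [h.fderiv_eigenvalue_apply hqU hn, hNq]
    simp
  intro Y hY hYV v hv
  exact (hiff q hqU _).2 (h.g_covDeriv_eq_zero hqU hσq hY
    (fun x hx => (hiff x hx _).1 (hYV x hx)) ((hiff q hqU v).1 hv))

end
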